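/- arXiv:2505.00952 — 2 statements merged into one kernel-verified Lean document; each statement's English description precedes it below -/
import Mathlib

section
/- Let A be a C*-algebra and let a ∈ A be positive with ‖a‖ ≤ 1. Let ε₁, ε₂ > 0. Then for every ε > 0 there exists δ > 0 such that for all positive y ∈ A with ‖y‖ = 1 and all positive c ∈ A with ‖c‖ ≤ 1 the following holds: if ‖y² a y² − a‖ < δ and ‖y c − c y‖ < δ, then (a − (ε + ε₁ + ε₂))₊ (identified with diag((a − (ε + ε₁ + ε₂))₊, 0) in M₂(A)) is Cuntz subequivalent in M₂(A) to the diagonal matrix diag((c (y a y) c − ε₁/2)₊, (y² − y c y − ε₂/2)₊). -/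
open Filter Topology

variable {A : Type*} [NonUnitalCStarAlgebra A] [PartialOrder A] [StarOrderedRing A]

/-- `(a - ε)₊`, the positive cut-down of `a`. -/
noncomputable def cutdown (a : A) (ε : ℝ) : A :=
  cfcₙ (fun t : ℝ => max (t - ε) 0) a

/-- Cuntz subequivalence in the matrix algebra `Mₙ(A)`: there is a sequence `(w k)` of
matrices with `w k * b * (w k)⋆ → a`.  (Since all C*-norms on `Mₙ(A)` are equivalent to
the product topology, this is norm convergence.) -/
def CuntzLEM {n : ℕ} (a b : Matrix (Fin n) (Fin n) A) : Prop :=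
  ∃ w : ℕ → Matrix (Fin n) (Fin n) A,
    Tendsto (fun k => w k * b * star (w k)) atTop (𝓝 a)

/-- An element dominated by `q` is a limit of elements of the form `v * q * star v`. -/
theorem mem_closure_range_conj_of_le {p q : A} (hp : 0 ≤ p) (hpq : p ≤ q) :
    p ∈ closure (Set.range fun v : A => v * q * star v) := by
  have hq : 0 ≤ q := hp.trans hpq
  set r := CFC.sqrt p
  have hr0 : 0 ≤ r := CFC.sqrt_nonneg p
  have hrr : r * r = p := CFC.sqrt_mul_sqrt_self p hp
  have hrs : star r = r := (IsSelfAdjoint.of_nonneg hr0).star_eq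
  let e : ℕ → A := fun n => cfcₙ (fun t : ℝ => |t| / (|t| + 1 / ((n : ℝ) + 1))) q
  let k : ℕ → A := fun n => cfcₙ (fun t : ℝ => √|t| / (|t| + 1 / ((n : ℝ) + 1))) q
  have hpos (n : ℕ) (t : ℝ) : 0 < |t| + 1 / ((n : ℝ) + 1) := by positivity
  have hce (n : ℕ) : Continuous fun t : ℝ => |t| / (|t| + 1 / ((n : ℝ) + 1)) :=
    continuous_abs.div (by fun_prop) fun t => (hpos n t).ne'
  have hck (n : ℕ) : Continuous fun t : ℝ => √|t| / (|t| + 1 / ((n : ℝ) + 1)) :=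
    continuous_abs.sqrt.div (by fun_prop) fun t => (hpos n t).ne'
  have hes (n : ℕ) : star (e n) = e n := (cfcₙ_predicate (R := ℝ) _ q : IsSelfAdjoint _).star_eq
  have hks (n : ℕ) : star (k n) = k n := (cfcₙ_predicate (R := ℝ) _ q : IsSelfAdjoint _).star_eq
  have hqid : cfcₙ (fun t : ℝ => t) q = q := cfcₙ_id' ℝ q
  have hkqk (n : ℕ) : k n * q * k n = e n * e n := by
    calc k n * q * k n = k n * cfcₙ (fun t : ℝ => t) q * k n := by rw [hqid]
      _ = e n * e n := by
        simp only [k, e]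
        rw [← cfcₙ_mul _ _ q (hck n).continuousOn (by simp) (by fun_prop) (by simp),
          ← cfcₙ_mul (fun t => √|t| / (|t| + 1 / ((n : ℝ) + 1)) * t) _ q
            ((hck n).mul continuous_id').continuousOn (by simp) (hck n).continuousOn (by simp),
          ← cfcₙ_mul _ _ q (hce n).continuousOn (by simp) (hce n).continuousOn (by simp)]
        refine cfcₙ_congr fun t ht => ?_
        have ht0 : 0 ≤ t := quasispectrum_nonneg_of_nonneg q hq t ht
        have hs := Real.mul_self_sqrt ht0
        have := (hpos n t).ne'
        simp only [abs_of_nonneg ht0] at this ⊢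
        field_simp
        rw [Real.sq_sqrt ht0]
        ring
  have hnorm (n : ℕ) : ‖r - r * e n‖ * ‖r - r * e n‖ ≤ 1 / ((n : ℝ) + 1) := by
    rw [← CStarRing.norm_star_mul_self]
    have h1 : star (r - r * e n) * (r - r * e n) =
        p - p * e n - e n * p + e n * p * e n := by
      simp only [star_sub, star_mul, hes, hrs, ← hrr]
      noncomm_ring
    have h2 : p - p * e n - e n * p + e n * p * e n ≤
        q - q * e n - e n * q + e n * q * e n := by
      set s := CFC.sqrt (q - p)
      have hss : s * s = q - p := CFC.sqrt_mul_sqrt_self _ (sub_nonneg.2 hpq)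
      have hst : star s = s := (IsSelfAdjoint.of_nonneg (CFC.sqrt_nonneg (q - p))).star_eq
      have h := star_mul_self_nonneg (s - s * e n)
      have h' : star (s - s * e n) * (s - s * e n) =
          (q - q * e n - e n * q + e n * q * e n) - (p - p * e n - e n * p + e n * p * e n) := by
        have : star (s - s * e n) * (s - s * e n) =
            s * s - s * s * e n - e n * (s * s) + e n * (s * s) * e n := by
          simp only [star_sub, star_mul, hes, hst]
          noncomm_ring
        rw [this, hss]
        noncomm_ring
      rw [h'] at h
      exact sub_nonneg.1 h
    have h3 : q - q * e n - e n * q + e n * q * e n =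
        cfcₙ (fun t : ℝ => t - t * (|t| / (|t| + 1 / ((n : ℝ) + 1)))
          - |t| / (|t| + 1 / ((n : ℝ) + 1)) * (t - t * (|t| / (|t| + 1 / ((n : ℝ) + 1))))) q := by
      have hexp (f : ℝ → ℝ) (hf : Continuous f) (hf0 : f 0 = 0) :
          q - q * cfcₙ f q - cfcₙ f q * q + cfcₙ f q * q * cfcₙ f q =
            cfcₙ (fun t => t - t * f t - f t * (t - t * f t)) q := by
        rw [cfcₙ_sub _ _ q (by fun_prop) (by simp) (by fun_prop) (by simp [hf0]),
          cfcₙ_mul _ _ q (by fun_prop) hf0 (by fun_prop) (by simp),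
          cfcₙ_sub _ _ q (by fun_prop) (by simp) (by fun_prop) (by simp),
          cfcₙ_mul _ _ q (by fun_prop) (by simp) (by fun_prop) hf0, hqid]
        noncomm_ring
      exact hexp _ (hce n) (by simp)
    rw [h1]
    refine (CStarAlgebra.norm_le_norm_of_nonneg_of_le (h1 ▸ star_mul_self_nonneg _) h2).trans ?_
    rw [h3]
    refine norm_cfcₙ_le fun t ht => ?_
    have ht0 : 0 ≤ t := quasispectrum_nonneg_of_nonneg q hq t ht
    have hd : (0 : ℝ) < 1 / ((n : ℝ) + 1) := by positivity
    rw [abs_of_nonneg ht0]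
    generalize 1 / ((n : ℝ) + 1) = d at hd
    have hp' : 0 < t + d := by positivity
    have : t - t * (t / (t + d)) - t / (t + d) * (t - t * (t / (t + d))) =
        t * d ^ 2 / (t + d) ^ 2 := by
      field_simp
      ring
    rw [this, Real.norm_of_nonneg (by positivity), div_le_iff₀ (by positivity)]
    nlinarith [mul_nonneg ht0 hd.le, mul_nonneg (mul_nonneg ht0 hd.le) hd.le,
      mul_nonneg (mul_nonneg ht0 ht0) hd.le, pow_pos hd 3]
  have hlim : Tendsto (fun n => r * e n) atTop (𝓝 r) := by
    rw [tendsto_iff_norm_sub_tendsto_zero]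
    have hsq : Tendsto (fun n : ℕ => √(1 / ((n : ℝ) + 1))) atTop (𝓝 0) := by
      simpa using (tendsto_one_div_add_atTop_nhds_zero_nat (𝕜 := ℝ)).sqrt
    refine squeeze_zero (fun _ => norm_nonneg _) (fun n => ?_) hsq
    rw [norm_sub_rev]
    exact Real.le_sqrt_of_sq_le (by rw [sq]; exact hnorm n)
  have hlim2 : Tendsto (fun n => (r * k n) * q * star (r * k n)) atTop (𝓝 p) := by
    have h := hlim.mul hlim.star
    rw [hrs, hrr] at h
    refine h.congr fun n => ?_
    rw [star_mul, star_mul, hes, hks, hrs]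
    calc r * e n * (e n * r) = r * (e n * e n) * r := by noncomm_ring
      _ = r * k n * q * (k n * r) := by rw [← hkqk]; noncomm_ring
  exact mem_closure_of_tendsto hlim2 (Eventually.of_forall fun n => ⟨_, rfl⟩)

/-- Cutting down a positive element by `η` moves it by at most `η`. -/
theorem norm_sub_cutdown_le {a : A} (ha : 0 ≤ a) {η : ℝ} (hη : 0 ≤ η) :
    ‖a - cutdown a η‖ ≤ η := by
  have h : a - cutdown a η = cfcₙ (fun t : ℝ => t - max (t - η) 0) a := by
    rw [cfcₙ_sub _ _ a (by fun_prop) (by simp) (by fun_prop) (by simpa using hη), cfcₙ_id' ℝ a,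
      cutdown]
  rw [h]
  refine norm_cfcₙ_le fun t ht => ?_
  have ht0 : 0 ≤ t := quasispectrum_nonneg_of_nonneg a ha t ht
  rw [Real.norm_eq_abs, abs_le]
  rcases max_cases (t - η) 0 with h | h <;> constructor <;> linarith

theorem cutdown_nonneg (a : A) (η : ℝ) : 0 ≤ cutdown a η :=
  cfcₙ_nonneg fun _ _ => le_max_right _ _

/-- If `a ≤ d + z` with `‖z‖ ≤ η`, then `(a - η)₊` is Cuntz below `d`. -/
theorem cutdown_mem_closure_range_conj {a d z : A} (ha : 0 ≤ a) {η : ℝ} (hη : 0 ≤ η)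
    (hz : IsSelfAdjoint z) (hzη : ‖z‖ ≤ η) (h : a ≤ d + z) :
    cutdown a η ∈ closure (Set.range fun v : A => v * d * star v) := by
  let g : ℕ → ℝ → ℝ := fun n t => min 1 (((n : ℝ) + 1) * max (t - η) 0)
  have hg (n : ℕ) : Continuous (g n) := by fun_prop
  have hg0 (n : ℕ) : g n 0 = 0 := by simp [g, hη]
  let x : ℕ → A := fun n => cfcₙ (g n) a
  have hxs (n : ℕ) : star (x n) = x n := (cfcₙ_predicate (R := ℝ) _ a : IsSelfAdjoint _).star_eq
  let p : ℕ → A := fun n => cfcₙ (fun t => g n t * t * g n t - η • (g n t * g n t)) a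
  have hp (n : ℕ) : p n = x n * a * x n - η • (x n * x n) := by
    have c1 := hg n
    have z1 := hg0 n
    simp only [p, x]
    rw [cfcₙ_sub _ _ a (by fun_prop) (by simp [z1]) (by fun_prop) (by simp [z1]),
      cfcₙ_smul _ _ a (by fun_prop) (by simp [z1]),
      cfcₙ_mul _ _ a (by fun_prop) (by simp [z1]) (by fun_prop) (by simp [z1]),
      cfcₙ_mul _ _ a (by fun_prop) (by simp [z1]) (by fun_prop) (by simp),
      cfcₙ_mul _ _ a (by fun_prop) (by simp [z1]) (by fun_prop) (by simp [z1]), cfcₙ_id' ℝ a]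
  have hp0 (n : ℕ) : 0 ≤ p n := by
    refine cfcₙ_nonneg fun t _ => ?_
    rcases le_total t η with ht | ht
    · simp [g, ht]
    · have : g n t * t * g n t - η • (g n t * g n t) = g n t ^ 2 * (t - η) := by
        rw [smul_eq_mul]; ring
      rw [this]
      exact mul_nonneg (sq_nonneg _) (sub_nonneg.2 ht)
  have hpd (n : ℕ) : p n ≤ x n * d * x n := by
    have h1 := star_left_conjugate_le_conjugate h (x n)
    have h2 := CStarAlgebra.star_left_conjugate_le_norm_smul (a := x n) hz
    have h3 : ‖z‖ • (star (x n) * x n) ≤ η • (star (x n) * x n) :=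
      smul_le_smul_of_nonneg_right hzη (star_mul_self_nonneg _)
    rw [hxs] at h1 h2 h3
    rw [hp, sub_le_iff_le_add]
    refine h1.trans ?_
    rw [mul_add, add_mul]
    gcongr
    exact h2.trans h3
  have hlim : Tendsto p atTop (𝓝 (cutdown a η)) := by
    rw [tendsto_iff_norm_sub_tendsto_zero]
    refine squeeze_zero (fun _ => norm_nonneg _) (fun n => ?_)
      (tendsto_one_div_add_atTop_nhds_zero_nat (𝕜 := ℝ))
    have c1 := hg n
    have z1 := hg0 n
    simp only [p, cutdown]
    rw [← cfcₙ_sub _ _ a (by fun_prop) (by simp [z1]) (by fun_prop) (by simp [hη])]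
    refine norm_cfcₙ_le fun t _ => ?_
    have hn : (0 : ℝ) < (n : ℝ) + 1 := by positivity
    rw [smul_eq_mul]
    rcases le_total t η with ht | ht
    · simp [g, ht]
      positivity
    · have hmax : max (t - η) 0 = t - η := max_eq_left (sub_nonneg.2 ht)
      have ht' := sub_nonneg.2 ht
      simp only [g, hmax]
      rcases le_total 1 (((n : ℝ) + 1) * (t - η)) with h1 | h1
      · rw [min_eq_left h1]
        simp
        positivity
      · rw [min_eq_right h1]
        set m := ((n : ℝ) + 1) * (t - η) with hm
        have hm0 : 0 ≤ m := by positivity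
        have e1 : m * t * m - η * (m * m) - (t - η) = -((t - η) * (1 - m * m)) := by ring
        rw [e1, norm_neg, Real.norm_of_nonneg (mul_nonneg ht' (by nlinarith)),
          le_div_iff₀ hn]
        nlinarith [mul_nonneg hm0 (mul_nonneg hm0 hm0)]
  refine isClosed_closure.mem_of_tendsto hlim (Eventually.of_forall fun n => ?_)
  refine closure_mono ?_ (mem_closure_range_conj_of_le (hp0 n) (hpd n))
  rintro _ ⟨v, rfl⟩
  refine ⟨v * x n, ?_⟩
  simp only [star_mul, hxs, mul_assoc]

/-- `a ≾ 2ycy + 2h` in `B` gives `a ⊕ 0 ≾ c ⊕ h` in `M₂(B)`. -/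
theorem cuntzLEM_diagonal_of_mem_closure {B : Type*} [NonUnitalCStarAlgebra B]
    {a c h y : B} (hy : star y = y)
    (ha : a ∈ closure (Set.range fun v : B =>
      v * ((2 : ℝ) • (y * c * y) + (2 : ℝ) • h) * star v)) :
    CuntzLEM (Matrix.diagonal ![a, 0]) (Matrix.diagonal ![c, h]) := by
  obtain ⟨u, hu, hlim⟩ := mem_closure_iff_seq_limit.1 ha
  choose v hv using hu
  refine ⟨fun n => !![√2 • (v n * y), √2 • v n; 0, 0], ?_⟩
  have key (n : ℕ) : (!![√2 • (v n * y), √2 • v n; 0, 0] : Matrix (Fin 2) (Fin 2) B) *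
      Matrix.diagonal ![c, h] * star !![√2 • (v n * y), √2 • v n; 0, 0] =
      Matrix.diagonal ![u n, 0] := by
    have h2 : √2 * √2 = (2 : ℝ) := Real.mul_self_sqrt (by norm_num)
    ext i j
    fin_cases i <;> fin_cases j <;>
      simp [Matrix.mul_apply, Matrix.vecMul, dotProduct, Fin.sum_univ_two, Matrix.star_apply,
        Matrix.diagonal_apply, ← hv, smul_mul_assoc, mul_smul_comm, smul_smul, h2, hy, mul_add,
        add_mul, mul_assoc]
  simp only [key]
  refine tendsto_pi_nhds.2 fun i => tendsto_pi_nhds.2 fun j => ?_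
  fin_cases i <;> fin_cases j <;> simp [hlim]

theorem conj_le_two_smul_conj_add {y c b : A} (hy : star y = y) (hc : star c = c) (hb : 0 ≤ b) :
    y * b * y ≤ (2 : ℝ) • (y * (c * b * c) * y) +
      (2 : ℝ) • ((y - y * c) * b * (y - c * y)) := by
  have h := star_left_conjugate_nonneg hb (c * y - (y - c * y))
  have e : star (c * y - (y - c * y)) * b * (c * y - (y - c * y)) =
      (2 : ℝ) • (y * (c * b * c) * y) + (2 : ℝ) • ((y - y * c) * b * (y - c * y))
        - y * b * y := by
    simp only [star_sub, star_mul, hy, hc, two_smul]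
    noncomm_ring
  rw [e] at h
  exact sub_nonneg.1 h

/-- Let `a ∈ A` be positive with `‖a‖ ≤ 1` and let `ε₁, ε₂ > 0`.
For every `ε > 0` there is `δ > 0` such that for every positive `y` with `‖y‖ = 1` and
every positive contraction `c`, if `‖y² a y² - a‖ < δ` and `‖y c - c y‖ < δ` then
`(a - (ε + ε₁ + ε₂))₊ ⊕ 0 ≾ (c (y a y) c - ε₁/2)₊ ⊕ (y² - y c y - ε₂/2)₊` in `M₂(A)`. -/
theorem cutdown_cuntzLE_of_almost_commuting
    (a : A) (ha : 0 ≤ a) (ha1 : ‖a‖ ≤ 1)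
    (ε₁ ε₂ : ℝ) (hε₁ : 0 < ε₁) (hε₂ : 0 < ε₂) (ε : ℝ) (hε : 0 < ε) :
    ∃ δ : ℝ, 0 < δ ∧
      ∀ y c : A, 0 ≤ y → ‖y‖ = 1 → 0 ≤ c → ‖c‖ ≤ 1 →
        ‖y * y * a * (y * y) - a‖ < δ → ‖y * c - c * y‖ < δ →
        CuntzLEM (Matrix.diagonal ![cutdown a (ε + ε₁ + ε₂), 0])
          (Matrix.diagonal ![cutdown (c * (y * a * y) * c) (ε₁ / 2),
                             cutdown (y * y - y * c * y) (ε₂ / 2)]) := by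
  refine ⟨ε, hε, fun y c hy hy1 hc hc1 hyay _ => ?_⟩
  have hys : star y = y := (IsSelfAdjoint.of_nonneg hy).star_eq
  have hcs : star c = c := (IsSelfAdjoint.of_nonneg hc).star_eq
  have hb : 0 ≤ y * a * y := conjugate_nonneg_of_nonneg ha hy
  have hcbc : 0 ≤ c * (y * a * y) * c := conjugate_nonneg_of_nonneg hb hc
  have hycy : 0 ≤ y * c * y := conjugate_nonneg_of_nonneg hc hy
  have hconj {u x : A} (hu : 0 ≤ u) (hu1 : ‖u‖ ≤ 1) (hx : star x = x) :
      x * u * x ≤ x * x := by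
    have h1 := CStarAlgebra.star_left_conjugate_le_norm_smul (a := x) (IsSelfAdjoint.of_nonneg hu)
    have h2 := smul_le_smul_of_nonneg_right hu1 (star_mul_self_nonneg x)
    rw [hx] at h1 h2
    simpa using h1.trans h2
  have hh : 0 ≤ y * y - y * c * y := sub_nonneg.2 (hconj hc hc1 hys)
  have hyy : ‖y * y‖ ≤ 1 := (norm_mul_le _ _).trans (by simp [hy1])
  have hh1 : ‖y * y - y * c * y‖ ≤ 1 :=
    (CStarAlgebra.norm_le_norm_of_nonneg_of_le hh (sub_le_self _ hycy)).trans hyy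
  have hhah : (y - y * c) * (y * a * y) * (y - c * y) ≤ y * y - y * c * y := by
    set h := y * y - y * c * y with hdef
    have hhs : star h = h := (IsSelfAdjoint.of_nonneg hh).star_eq
    have e : (y - y * c) * (y * a * y) * (y - c * y) = h * a * h := by
      rw [hdef]; noncomm_ring
    rw [e]
    refine (hconj ha ha1 hhs).trans ?_
    set s := CFC.sqrt h
    have hs : star s = s := (IsSelfAdjoint.of_nonneg (CFC.sqrt_nonneg h)).star_eq
    have hss : s * s = h := CFC.sqrt_mul_sqrt_self h hh
    calc h * h = s * h * s := by rw [← hss]; noncomm_ring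
      _ ≤ s * s := hconj hh hh1 hs
      _ = h := hss
  set C := cutdown (c * (y * a * y) * c) (ε₁ / 2)
  set h := y * y - y * c * y
  set H := cutdown h (ε₂ / 2)
  have hC : ‖c * (y * a * y) * c - C‖ ≤ ε₁ / 2 := norm_sub_cutdown_le hcbc (by positivity)
  have hH : ‖h - H‖ ≤ ε₂ / 2 := norm_sub_cutdown_le hh (by positivity)
  have hCs : star C = C := (IsSelfAdjoint.of_nonneg (cutdown_nonneg _ _)).star_eq
  have hHs : star H = H := (IsSelfAdjoint.of_nonneg (cutdown_nonneg _ _)).star_eq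
  have has : star a = a := (IsSelfAdjoint.of_nonneg ha).star_eq
  have hhs : star h = h := (IsSelfAdjoint.of_nonneg hh).star_eq
  refine cuntzLEM_diagonal_of_mem_closure hys <| cutdown_mem_closure_range_conj ha (by positivity)
    (z := (a - y * (y * a * y) * y) + (2 : ℝ) • (y * (c * (y * a * y) * c - C) * y) +
      (2 : ℝ) • (h - H)) ?_ ?_ ?_
  · simp [IsSelfAdjoint, star_add, star_sub, star_smul, star_mul, hys, hcs, hCs, hHs, has, hhs,
      mul_assoc]
  · have h1 : ‖a - y * (y * a * y) * y‖ ≤ ε := by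
      rw [norm_sub_rev]
      have e : y * (y * a * y) * y = y * y * a * (y * y) := by noncomm_ring
      rw [e]
      exact hyay.le
    have h2 : ‖y * (c * (y * a * y) * c - C) * y‖ ≤ ε₁ / 2 :=
      calc _ ≤ ‖y‖ * ‖c * (y * a * y) * c - C‖ * ‖y‖ :=
            (norm_mul_le _ _).trans (by gcongr; exact norm_mul_le _ _)
        _ ≤ ε₁ / 2 := by simpa [hy1] using hC
    refine (norm_add₃_le).trans ?_
    rw [norm_smul, norm_smul, Real.norm_of_nonneg (by norm_num : (0 : ℝ) ≤ 2)]
    linarith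
  · have h1 := conj_le_two_smul_conj_add hys hcs hb
    have h2 := smul_le_smul_of_nonneg_left hhah (by norm_num : (0 : ℝ) ≤ 2)
    have h3 := h1.trans (add_le_add_right h2 _)
    calc a = (a - y * (y * a * y) * y) + y * (y * a * y) * y := by abel
      _ ≤ (a - y * (y * a * y) * y) +
          ((2 : ℝ) • (y * (c * (y * a * y) * c) * y) + (2 : ℝ) • h) := by gcongr
      _ = _ := by
        simp only [mul_sub, sub_mul, smul_sub]
        abel
end

section
/- Let A be a simple infinite-dimensional (not necessarily unital) C*-algebra and let α : G → Aut(A) be an action of a finite group G on A with the weak tracial Rokhlin property. Let a, b be positive elements of the fixed point algebra A^α and assume that 0 is an accumulation point of the spectrum of b. Then a is Cuntz subequivalent to b in A if and only if a is Cuntz subequivalent to b in A^α (i.e., the witnessing sequence can be taken inside A^α). -/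
open Filter Topology

variable {A : Type*} [NonUnitalCStarAlgebra A] [PartialOrder A] [StarOrderedRing A]

/-- Cuntz subequivalence of `a` and `b`, with the witnessing sequence taken from `S`:
there is a sequence `(w n)` in `S` with `‖w n * b * (w n)⋆ - a‖ → 0`.
Taking `S = Set.univ` gives Cuntz subequivalence in `A`. -/
def CuntzLEIn (S : Set A) (a b : A) : Prop :=
  ∃ w : ℕ → A, (∀ n, w n ∈ S) ∧
    Tendsto (fun n => ‖w n * b * star (w n) - a‖) atTop (𝓝 0)

/-- A C*-algebra is simple if it is nonzero and its only closed two-sided ideals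
are `⊥` and `⊤`. -/
def IsSimpleCStarAlgebra (A : Type*) [NonUnitalCStarAlgebra A] : Prop :=
  (∃ a : A, a ≠ 0) ∧ ∀ I : TwoSidedIdeal A, IsClosed (I : Set A) → I = ⊥ ∨ I = ⊤

/-- The fixed point algebra of an action `α` of `G` on `A`. -/
def fixedPts {G : Type*} (α : G → A ≃⋆ₐ[ℂ] A) : Set A :=
  {a : A | ∀ g : G, α g a = a}

/-- The weak tracial Rokhlin property for an action of a finite group `G` on a simple
C*-algebra `A`: for every `ε > 0`, finite set `F ⊆ A`, and positive `x, y ∈ A` with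
`‖x‖ = 1` there are pairwise orthogonal positive contractions `f g` such that, with
`f = ∑ g, f g`: `f g` almost commutes with `F`, `α g (f h)` is close to `f (g * h)`,
`(y² - y f y - ε)₊ ≾_A x`, and `‖f x f‖ > 1 - ε`. -/
def WeakTracialRokhlin {G : Type*} [Group G] [Fintype G] (α : G → A ≃⋆ₐ[ℂ] A) : Prop :=
  ∀ (ε : ℝ), 0 < ε → ∀ (F : Finset A) (x y : A), 0 ≤ x → 0 ≤ y → ‖x‖ = 1 →
    ∃ f : G → A,
      (∀ g, 0 ≤ f g) ∧ (∀ g, ‖f g‖ ≤ 1) ∧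
      (∀ g h, g ≠ h → f g * f h = 0) ∧
      (∀ g, ∀ a ∈ F, ‖a * f g - f g * a‖ < ε) ∧
      (∀ g h, ‖α g (f h) - f (g * h)‖ < ε) ∧
      CuntzLEIn Set.univ (cutdown (y * y - y * (∑ g : G, f g) * y) ε) x ∧
      ‖(∑ g : G, f g) * x * (∑ g : G, f g)‖ > 1 - ε

/-- Polynomials converging to the square root uniformly on `[0, 1]`. -/
noncomputable def sqrtApprox : ℕ → ℝ → ℝ
  | 0, _ => 0
  | n + 1, t => sqrtApprox n t + (1 / 2 : ℝ) * (t - sqrtApprox n t * sqrtApprox n t)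

lemma continuous_sqrtApprox (n : ℕ) : Continuous (sqrtApprox n) := by
  induction n with
  | zero => exact continuous_const
  | succ n ih =>
    change Continuous fun t => sqrtApprox n t + (1 / 2 : ℝ) * (t - sqrtApprox n t * sqrtApprox n t)
    fun_prop

lemma sqrtApprox_zero (n : ℕ) : sqrtApprox n 0 = 0 := by
  induction n with
  | zero => rfl
  | succ n ih => simp [sqrtApprox, ih]

lemma sqrtApprox_bounds (n : ℕ) {s : ℝ} (hs : 0 ≤ s) (hs1 : s ≤ 1) :
    0 ≤ sqrtApprox n (s * s) ∧ sqrtApprox n (s * s) ≤ s ∧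
      (s - sqrtApprox n (s * s)) * (2 + n * s) ≤ 2 * s := by
  induction n with
  | zero => simp [sqrtApprox, hs]; linarith
  | succ n ih =>
    obtain ⟨h0, h1, h2⟩ := ih
    simp only [sqrtApprox]
    set p := sqrtApprox n (s * s)
    have hn : (0 : ℝ) ≤ n := n.cast_nonneg
    refine ⟨by nlinarith, by nlinarith, ?_⟩
    push_cast
    have e : s - (p + 1 / 2 * (s * s - p * p)) = (s - p) * (1 - (s + p) / 2) := by ring
    have h3 : (1 - (s + p) / 2) * (2 + (n + 1) * s) ≤ 2 + n * s := by
      have : 0 ≤ (n : ℝ) * s := by positivity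
      have : 0 ≤ p * (n * s) := by positivity
      have : 0 ≤ p * s := by positivity
      have : 0 ≤ n * s * s := by positivity
      nlinarith
    calc _ = (s - p) * ((1 - (s + p) / 2) * (2 + (n + 1) * s)) := by rw [e]; ring
      _ ≤ (s - p) * (2 + n * s) := mul_le_mul_of_nonneg_left h3 (by linarith)
      _ ≤ _ := h2

lemma abs_sqrtApprox_mul_self_sub_le (n : ℕ) {t : ℝ} (ht : 0 ≤ t) (ht1 : t ≤ 1) :
    |sqrtApprox (n + 1) t * sqrtApprox (n + 1) t - t| ≤ 4 / (n + 1) := by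
  obtain ⟨s, hs, rfl⟩ : ∃ s : ℝ, 0 ≤ s ∧ t = s * s :=
    ⟨√t, Real.sqrt_nonneg t, (Real.mul_self_sqrt ht).symm⟩
  have hs1 : s ≤ 1 := by nlinarith
  obtain ⟨h0, h1, h2⟩ := sqrtApprox_bounds (n + 1) hs hs1
  set p := sqrtApprox (n + 1) (s * s)
  push_cast at h2
  rw [abs_sub_comm, abs_of_nonneg (by nlinarith), le_div_iff₀ (by positivity)]
  have h3 : (s - p) * s * (n + 1) ≤ 2 * s := by nlinarith
  nlinarith [mul_nonneg (mul_nonneg (sub_nonneg.2 h1) (sub_nonneg.2 h1))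
    (by positivity : (0 : ℝ) ≤ n + 1)]

lemma sqrtApprox_mem_Icc (n : ℕ) {t : ℝ} (ht : 0 ≤ t) (ht1 : t ≤ 1) :
    0 ≤ sqrtApprox n t ∧ sqrtApprox n t ≤ 1 := by
  obtain ⟨s, hs, rfl⟩ : ∃ s : ℝ, 0 ≤ s ∧ t = s * s :=
    ⟨√t, Real.sqrt_nonneg t, (Real.mul_self_sqrt ht).symm⟩
  have hs1 : s ≤ 1 := by nlinarith
  obtain ⟨h0, h1, -⟩ := sqrtApprox_bounds n hs hs1
  exact ⟨h0, h1.trans hs1⟩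

lemma cfcₙ_sqrtApprox_zero (f : A) : cfcₙ (sqrtApprox 0) f = 0 :=
  cfcₙ_const_zero ℝ f

lemma cfcₙ_sqrtApprox_succ (n : ℕ) (f : A) (hf : IsSelfAdjoint f) :
    cfcₙ (sqrtApprox (n + 1)) f = cfcₙ (sqrtApprox n) f +
      (1 / 2 : ℝ) • (f - cfcₙ (sqrtApprox n) f * cfcₙ (sqrtApprox n) f) := by
  have hc := (continuous_sqrtApprox n).continuousOn (s := quasispectrum ℝ f)
  have h0 := sqrtApprox_zero n
  have hcc : Continuous (sqrtApprox n) := continuous_sqrtApprox n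
  change cfcₙ (fun t => sqrtApprox n t + (1 / 2 : ℝ) * (t - sqrtApprox n t * sqrtApprox n t)) f = _
  rw [cfcₙ_add (a := f) (f := fun t => sqrtApprox n t) (hf := hc) (hf0 := h0) (hg := by fun_prop)
      (hg0 := by simp [h0]),
    cfcₙ_const_mul _ _ f (by fun_prop) (by simp [h0]),
    cfcₙ_sub _ _ f (by fun_prop) rfl (by fun_prop) (by simp [h0]), cfcₙ_id' ℝ f,
    cfcₙ_mul _ _ f hc h0 hc h0]

lemma quasispectrum_mem_Icc {f : A} (hf : 0 ≤ f) (hf1 : ‖f‖ ≤ 1) {t : ℝ}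
    (ht : t ∈ quasispectrum ℝ f) : 0 ≤ t ∧ t ≤ 1 :=
  ⟨quasispectrum_nonneg_of_nonneg f hf t ht,
    (le_abs_self t).trans
      ((NonUnitalIsometricContinuousFunctionalCalculus.norm_quasispectrum_le f ht
        (IsSelfAdjoint.of_nonneg hf)).trans hf1)⟩

lemma norm_cfcₙ_sqrtApprox_le (n : ℕ) {f : A} (hf : 0 ≤ f) (hf1 : ‖f‖ ≤ 1) :
    ‖cfcₙ (sqrtApprox n) f‖ ≤ 1 := by
  refine norm_cfcₙ_le fun t ht => ?_
  obtain ⟨h0, h1⟩ := quasispectrum_mem_Icc hf hf1 ht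
  obtain ⟨h2, h3⟩ := sqrtApprox_mem_Icc n h0 h1
  rwa [Real.norm_of_nonneg h2]

lemma norm_cfcₙ_sqrtApprox_mul_self_sub_le (n : ℕ) {f : A} (hf : 0 ≤ f) (hf1 : ‖f‖ ≤ 1) :
    ‖cfcₙ (sqrtApprox (n + 1)) f * cfcₙ (sqrtApprox (n + 1)) f - f‖ ≤ 4 / (n + 1) := by
  have hc := (continuous_sqrtApprox (n + 1)).continuousOn (s := quasispectrum ℝ f)
  have hcc := continuous_sqrtApprox (n + 1)
  have h0 := sqrtApprox_zero (n + 1)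
  nth_rw 3 [← cfcₙ_id' ℝ f]
  rw [← cfcₙ_mul _ _ f hc h0 hc h0, ← cfcₙ_sub _ _ f (by fun_prop) (by simp [h0])]
  refine norm_cfcₙ_le fun t ht => ?_
  obtain ⟨h2, h3⟩ := quasispectrum_mem_Icc hf hf1 ht
  exact abs_sqrtApprox_mul_self_sub_le n h2 h3

lemma norm_commutator_cfcₙ_sqrtApprox_le (n : ℕ) {f : A} (hf : 0 ≤ f) (hf1 : ‖f‖ ≤ 1) (w : A) :
    ‖w * cfcₙ (sqrtApprox n) f - cfcₙ (sqrtApprox n) f * w‖ ≤ 3 ^ n * ‖w * f - f * w‖ := by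
  induction n with
  | zero => simp [cfcₙ_sqrtApprox_zero]
  | succ n ih =>
    rw [cfcₙ_sqrtApprox_succ n f (.of_nonneg hf)]
    have hp := norm_cfcₙ_sqrtApprox_le n hf hf1
    set p := cfcₙ (sqrtApprox n) f
    have e : w * (p + (1 / 2 : ℝ) • (f - p * p)) - (p + (1 / 2 : ℝ) • (f - p * p)) * w =
        (w * p - p * w) + (1 / 2 : ℝ) • ((w * f - f * w) -
          ((w * p - p * w) * p + p * (w * p - p * w))) := by
      simp only [mul_add, add_mul, mul_sub, sub_mul, mul_smul_comm, smul_mul_assoc, smul_add,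
        smul_sub, mul_assoc]
      abel
    have h1 : ‖(w * p - p * w) * p‖ ≤ ‖w * p - p * w‖ :=
      (norm_mul_le _ _).trans (mul_le_of_le_one_right (norm_nonneg _) hp)
    have h2 : ‖p * (w * p - p * w)‖ ≤ ‖w * p - p * w‖ :=
      (norm_mul_le _ _).trans (mul_le_of_le_one_left (norm_nonneg _) hp)
    have h3 : (1 : ℝ) ≤ 3 ^ n := one_le_pow₀ (by norm_num)
    rw [e]
    refine (norm_add_le _ _).trans ?_
    rw [norm_smul, Real.norm_of_nonneg (by norm_num)]
    have h4 := norm_sub_le (w * f - f * w) ((w * p - p * w) * p + p * (w * p - p * w))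
    have h5 := norm_add_le ((w * p - p * w) * p) (p * (w * p - p * w))
    rw [pow_succ]
    nlinarith [norm_nonneg (w * f - f * w)]

lemma norm_cfcₙ_sqrtApprox_sub_le (n : ℕ) {f g : A} (hf : 0 ≤ f) (hf1 : ‖f‖ ≤ 1)
    (hg : 0 ≤ g) (hg1 : ‖g‖ ≤ 1) :
    ‖cfcₙ (sqrtApprox n) f - cfcₙ (sqrtApprox n) g‖ ≤ 3 ^ n * ‖f - g‖ := by
  induction n with
  | zero => simp [cfcₙ_sqrtApprox_zero]
  | succ n ih =>
    rw [cfcₙ_sqrtApprox_succ n f (.of_nonneg hf), cfcₙ_sqrtApprox_succ n g (.of_nonneg hg)]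
    have hp := norm_cfcₙ_sqrtApprox_le n hf hf1
    have hq := norm_cfcₙ_sqrtApprox_le n hg hg1
    set p := cfcₙ (sqrtApprox n) f
    set q := cfcₙ (sqrtApprox n) g
    have e : p + (1 / 2 : ℝ) • (f - p * p) - (q + (1 / 2 : ℝ) • (g - q * q)) =
        (p - q) + (1 / 2 : ℝ) • ((f - g) - ((p - q) * p + q * (p - q))) := by
      simp only [mul_sub, sub_mul, smul_add, smul_sub]
      abel
    have h1 : ‖(p - q) * p‖ ≤ ‖p - q‖ :=
      (norm_mul_le _ _).trans (mul_le_of_le_one_right (norm_nonneg _) hp)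
    have h2 : ‖q * (p - q)‖ ≤ ‖p - q‖ :=
      (norm_mul_le _ _).trans (mul_le_of_le_one_left (norm_nonneg _) hq)
    have h3 : (1 : ℝ) ≤ 3 ^ n := one_le_pow₀ (by norm_num)
    rw [e]
    refine (norm_add_le _ _).trans ?_
    rw [norm_smul, Real.norm_of_nonneg (by norm_num)]
    have h4 := norm_sub_le (f - g) ((p - q) * p + q * (p - q))
    have h5 := norm_add_le ((p - q) * p) (q * (p - q))
    rw [pow_succ]
    nlinarith [norm_nonneg (f - g)]

lemma cfcₙ_sqrtApprox_mul_eq_zero (n : ℕ) {f g : A} (hf : IsSelfAdjoint f) (h : f * g = 0) :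
    cfcₙ (sqrtApprox n) f * g = 0 := by
  induction n with
  | zero => simp [cfcₙ_sqrtApprox_zero]
  | succ n ih =>
    rw [cfcₙ_sqrtApprox_succ n f hf]
    rw [add_mul, smul_mul_assoc, sub_mul, mul_assoc, ih, h, mul_zero, sub_zero, smul_zero, add_zero]

lemma cfcₙ_sqrtApprox_mul_cfcₙ_sqrtApprox_eq_zero (n : ℕ) {f g : A} (hf : IsSelfAdjoint f)
    (hg : IsSelfAdjoint g) (h : f * g = 0) :
    cfcₙ (sqrtApprox n) f * cfcₙ (sqrtApprox n) g = 0 := by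
  have h1 := cfcₙ_sqrtApprox_mul_eq_zero n hf h
  have hs : ∀ x : A, IsSelfAdjoint (cfcₙ (sqrtApprox n) x) := fun x => cfcₙ_predicate _ x
  have h2 : g * cfcₙ (sqrtApprox n) f = 0 := by
    simpa [hg.star_eq, (hs f).star_eq] using congr(star $h1)
  simpa [(hs f).star_eq, (hs g).star_eq] using congrArg star (cfcₙ_sqrtApprox_mul_eq_zero n hg h2)

lemma map_cfcₙ_real (φ : A ≃⋆ₐ[ℂ] A) (h : ℝ → ℝ) (hc : Continuous h) (h0 : h 0 = 0) (a : A)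
    (ha : IsSelfAdjoint a) : φ (cfcₙ h a) = cfcₙ h (φ a) :=
  NonUnitalStarAlgHomClass.map_cfcₙ (S := ℂ) φ h a hc.continuousOn h0
    (StarAlgEquiv.isometry φ).continuous ha (ha.map φ)

lemma norm_sum_le_one_of_orthogonal {ι : Type*} (s : Finset ι) {f : ι → A}
    (hf : ∀ i, IsSelfAdjoint (f i)) (hf1 : ∀ i, ‖f i‖ ≤ 1)
    (h : ∀ i j, i ≠ j → f i * f j = 0) : ‖∑ i ∈ s, f i‖ ≤ 1 := by
  classical
  induction s using Finset.induction with
  | empty => simp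
  | insert j s hj ih =>
    have hne : ∀ i ∈ s, i ≠ j := fun i hi hij => hj (hij ▸ hi)
    have h1 : f j * ∑ i ∈ s, f i = 0 := by
      rw [Finset.mul_sum]
      exact Finset.sum_eq_zero fun i hi => h _ _ (hne i hi).symm
    have h2 : (∑ i ∈ s, f i) * f j = 0 := by
      rw [Finset.sum_mul]
      exact Finset.sum_eq_zero fun i hi => h _ _ (hne i hi)
    have hs : IsSelfAdjoint (∑ i ∈ s, f i) := isSelfAdjoint_sum _ fun i _ => hf i
    rw [Finset.sum_insert hj,
      (hf j).isStarNormal.norm_add_eq_max hs.isStarNormal (h1.trans h2.symm) h1]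
    exact max_le (hf1 j) ih

lemma norm_cutdown_sub_le {a : A} (ha : 0 ≤ a) {ε : ℝ} (hε : 0 ≤ ε) :
    ‖cutdown a ε - a‖ ≤ ε := by
  nth_rw 2 [← cfcₙ_id' ℝ a]
  rw [cutdown, ← cfcₙ_sub _ _ a (by fun_prop) (by simp [hε]) (by fun_prop) rfl]
  refine norm_cfcₙ_le fun t ht => ?_
  have h0 := quasispectrum_nonneg_of_nonneg a ha t ht
  rw [Real.norm_eq_abs, abs_le]
  constructor
  · linarith [le_max_left (t - ε) 0]
  · linarith [max_le (by linarith : t - ε ≤ t) h0]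

lemma mul_self_sub_conjugate_nonneg {y f : A} (hy : IsSelfAdjoint y) (hf : IsSelfAdjoint f)
    (hf1 : ‖f‖ ≤ 1) : 0 ≤ y * y - y * f * y := by
  have h := CStarAlgebra.star_left_conjugate_le_norm_smul (a := y) (b := f)
  rw [hy.star_eq] at h
  have hy0 : 0 ≤ y * y := hy.mul_self_nonneg
  refine sub_nonneg.2 (h.trans ?_)
  calc ‖f‖ • (y * y) ≤ (1 : ℝ) • (y * y) := smul_le_smul_of_nonneg_right hf1 hy0
    _ = y * y := one_smul _ _

lemma WeakTracialRokhlin.exists_sqrt {G : Type*} [Group G] [Fintype G] {α : G → A ≃⋆ₐ[ℂ] A}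
    (hα : WeakTracialRokhlin α) {ε : ℝ} (hε : 0 < ε) (F : Finset A) {x y : A} (hx : 0 ≤ x)
    (hy : 0 ≤ y) (hx1 : ‖x‖ = 1) :
    ∃ (u f : G → A) (v : A),
      (∀ g, IsSelfAdjoint (u g)) ∧ (∀ g, ‖u g‖ ≤ 1) ∧ (∀ g h, g ≠ h → u g * u h = 0) ∧
      (∀ g, ∀ a ∈ F, ‖a * u g - u g * a‖ ≤ ε) ∧
      (∀ g h, ‖α g (u h) - u (g * h)‖ ≤ ε) ∧
      (∀ g, ‖u g * u g - f g‖ ≤ ε) ∧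
      (∀ g, ‖f g‖ ≤ 1) ∧
      (∀ g, ∀ a ∈ F, ‖a * f g - f g * a‖ ≤ ε) ∧
      (∀ g h, ‖α g (f h) - f (g * h)‖ ≤ ε) ∧
      ‖v * x * star v - (y * y - y * (∑ g, f g) * y)‖ ≤ ε := by
  obtain ⟨n, hn⟩ := exists_nat_gt (4 / ε)
  have hn' : 4 / ((n : ℝ) + 1) ≤ ε := by
    rw [div_lt_iff₀ hε] at hn
    rw [div_le_iff₀ (by positivity)]
    nlinarith
  have h3 : (1 : ℝ) ≤ 3 ^ (n + 1) := one_le_pow₀ (by norm_num)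
  set δ : ℝ := ε / 2 / 3 ^ (n + 1) with hδ
  have hδ0 : 0 < δ := by positivity
  have hδ1 : 3 ^ (n + 1) * δ ≤ ε := by
    rw [hδ, mul_div_cancel₀ _ (by positivity)]
    linarith
  have hδ2 : δ ≤ ε / 2 := div_le_self (by positivity) h3
  obtain ⟨f, hf0, hf1, hfo, hfF, hfα, ⟨v, -, hv⟩, -⟩ := hα δ hδ0 F x y hx hy hx1
  have hsa : ∀ g, IsSelfAdjoint (f g) := fun g => .of_nonneg (hf0 g)
  obtain ⟨k, hk⟩ := ((tendsto_order.1 hv).2 (ε / 2) (by positivity)).exists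
  refine ⟨fun g => cfcₙ (sqrtApprox (n + 1)) (f g), f, v k, fun g => cfcₙ_predicate _ _,
    fun g => norm_cfcₙ_sqrtApprox_le _ (hf0 g) (hf1 g),
    fun g h hgh => cfcₙ_sqrtApprox_mul_cfcₙ_sqrtApprox_eq_zero _ (hsa g) (hsa h) (hfo g h hgh),
    fun g a ha => ?_, fun g h => ?_, fun g => ?_, hf1, fun g a ha => ?_, fun g h => ?_, ?_⟩
  · refine (norm_commutator_cfcₙ_sqrtApprox_le _ (hf0 g) (hf1 g) a).trans (le_trans ?_ hδ1)
    exact mul_le_mul_of_nonneg_left (hfF g a ha).le (by positivity)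
  · rw [map_cfcₙ_real _ _ (continuous_sqrtApprox _) (sqrtApprox_zero _) _ (hsa h)]
    refine (norm_cfcₙ_sqrtApprox_sub_le _ (map_nonneg (α g) (hf0 h))
      ((StarAlgEquiv.norm_map (α g) _).trans_le (hf1 h)) (hf0 _) (hf1 _)).trans (le_trans ?_ hδ1)
    exact mul_le_mul_of_nonneg_left (hfα g h).le (by positivity)
  · exact (norm_cfcₙ_sqrtApprox_mul_self_sub_le n (hf0 g) (hf1 g)).trans hn'
  · linarith [hfF g a ha]
  · linarith [hfα g h]
  · have hT := mul_self_sub_conjugate_nonneg (.of_nonneg hy)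
      (isSelfAdjoint_sum Finset.univ fun g _ => hsa g)
      (norm_sum_le_one_of_orthogonal Finset.univ hsa hf1 hfo)
    have h4 := norm_cutdown_sub_le hT hδ0.le
    refine (norm_sub_le_norm_sub_add_norm_sub _ _ _).trans (add_le_add hk.le
      (h4.trans hδ2) |>.trans_eq (add_halves ε))

set_option maxHeartbeats 400000 in
lemma exists_separating_cfc {b : A} (hb : 0 ≤ b)
    (hsp : AccPt (0 : ℝ) (𝓟 (quasispectrum ℝ b))) {δ : ℝ} (hδ : 0 < δ) :
    ∃ μ ν θ χ : ℝ → ℝ, (Continuous μ ∧ μ 0 = 0) ∧ (Continuous ν ∧ ν 0 = 0) ∧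
      (Continuous θ ∧ θ 0 = 0) ∧ (Continuous χ ∧ χ 0 = 0) ∧
      ‖cfcₙ μ b * b * cfcₙ μ b - b‖ ≤ δ ∧
      cfcₙ μ b * b * cfcₙ ν b = 0 ∧
      cfcₙ ν b * b * cfcₙ μ b = 0 ∧
      cfcₙ ν b * b * cfcₙ ν b = cfcₙ χ b ∧
      cfcₙ θ b * cfcₙ χ b = cfcₙ θ b ∧ 0 ≤ cfcₙ θ b ∧ ‖cfcₙ θ b‖ = 1 := by
  obtain ⟨t₀, ⟨ht1, ht⟩, ht0⟩ := accPt_iff_nhds.1 hsp _ (Metric.ball_mem_nhds 0 (half_pos hδ))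
  have hpos : 0 < t₀ := lt_of_le_of_ne (quasispectrum_nonneg_of_nonneg b hb _ ht) (Ne.symm ht0)
  have htδ : 2 * t₀ ≤ δ := by
    rw [Metric.mem_ball, dist_zero_right, Real.norm_of_nonneg hpos.le] at ht1
    linarith
  set μ : ℝ → ℝ := fun t => max 0 (min 1 (2 * t / t₀ - 3)) with hμ
  set χ : ℝ → ℝ := fun t => max 0 (min 1 (2 - 4 * |t / t₀ - 1|)) with hχ
  set ν : ℝ → ℝ := fun t => √(χ t / max t (t₀ / 2)) with hν
  set θ : ℝ → ℝ := fun t => max 0 (1 - 4 * |t / t₀ - 1|) with hθ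
  have hμc : Continuous μ := by fun_prop
  have hχc : Continuous χ := by fun_prop
  have hθc : Continuous θ := by fun_prop
  have hνc : Continuous ν := by
    refine Continuous.sqrt (hχc.div (by fun_prop) fun t => ?_)
    exact (lt_max_of_lt_right (by positivity)).ne'
  have hμ0 : μ 0 = 0 := by simp [hμ]
  have hχ0 : χ 0 = 0 := by norm_num [hχ]
  have hν0 : ν 0 = 0 := by simp [hν, hχ0]
  have hθ0 : θ 0 = 0 := by norm_num [hθ]
  have hprod : ∀ φ ψ : ℝ → ℝ, Continuous φ → φ 0 = 0 → Continuous ψ → ψ 0 = 0 →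
      cfcₙ φ b * b * cfcₙ ψ b = cfcₙ (fun t => φ t * t * ψ t) b := by
    intro φ ψ hφ hφ0 hψ hψ0
    rw [cfcₙ_mul (fun t => φ t * t) ψ b (by fun_prop) (by simp) hψ.continuousOn hψ0,
      cfcₙ_mul φ (fun t => t) b hφ.continuousOn hφ0 (by fun_prop) rfl, cfcₙ_id' ℝ b]
  have hμν : ∀ t, μ t * ν t = 0 := by
    intro t
    rcases le_total t (3 * t₀ / 2) with h | h
    · have : 2 * t / t₀ - 3 ≤ 0 := by
        rw [sub_nonpos, div_le_iff₀ hpos]; linarith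
      have : μ t = 0 := max_eq_left ((min_le_right _ _).trans this)
      rw [this, zero_mul]
    · have : 3 / 2 ≤ t / t₀ := by rw [le_div_iff₀ hpos]; linarith
      have : 2 - 4 * |t / t₀ - 1| ≤ 0 := by linarith [le_abs_self (t / t₀ - 1)]
      have : χ t = 0 := max_eq_left ((min_le_right _ _).trans this)
      simp [hν, this]
  refine ⟨μ, ν, θ, χ, ⟨hμc, hμ0⟩, ⟨hνc, hν0⟩, ⟨hθc, hθ0⟩, ⟨hχc, hχ0⟩, ?_, ?_, ?_, ?_, ?_, ?_, ?_⟩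
  · rw [hprod μ μ hμc hμ0 hμc hμ0]
    nth_rw 2 [← cfcₙ_id' ℝ b]
    rw [← cfcₙ_sub _ _ b (by fun_prop) (by simp) (by fun_prop) rfl]
    refine norm_cfcₙ_le fun t ht => ?_
    have h0 := quasispectrum_nonneg_of_nonneg b hb t ht
    have hm0 : 0 ≤ μ t := le_max_left _ _
    have hm1 : μ t ≤ 1 := max_le zero_le_one (min_le_left _ _)
    rcases le_total t (2 * t₀) with h | h
    · rw [Real.norm_eq_abs, abs_le]
      have h1 : 0 ≤ μ t * t * μ t := by positivity
      have h2 : μ t * t * μ t ≤ t := by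
        have := mul_le_mul hm1 hm1 hm0 zero_le_one
        nlinarith
      constructor <;> linarith
    · have : 1 ≤ 2 * t / t₀ - 3 := by
        rw [le_sub_iff_add_le, le_div_iff₀ hpos]; linarith
      have : μ t = 1 := by simp only [hμ]; rw [min_eq_left this]; simp
      simp [this, hδ.le]
  · rw [hprod μ ν hμc hμ0 hνc hν0, ← cfcₙ_const_zero ℝ b]
    congr 1; ext t
    rw [mul_right_comm, hμν, zero_mul]
  · rw [hprod ν μ hνc hν0 hμc hμ0, ← cfcₙ_const_zero ℝ b]
    congr 1; ext t
    rw [mul_right_comm, mul_comm (ν t), hμν, zero_mul]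
  · rw [hprod ν ν hνc hν0 hνc hν0]
    congr 1; ext t
    have hχn : 0 ≤ χ t := le_max_left _ _
    have hm : 0 < max t (t₀ / 2) := lt_max_of_lt_right (by positivity)
    have : ν t * ν t = χ t / max t (t₀ / 2) := Real.mul_self_sqrt (by positivity)
    rw [mul_right_comm, this]
    rcases le_total t (t₀ / 2) with h | h
    · have : t / t₀ ≤ 1 / 2 := by rw [div_le_iff₀ hpos]; linarith
      have : 2 - 4 * |t / t₀ - 1| ≤ 0 := by linarith [neg_le_abs (t / t₀ - 1)]
      have : χ t = 0 := max_eq_left ((min_le_right _ _).trans this)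
      simp [this]
    · rw [max_eq_left h, div_mul_cancel₀]
      linarith
  · rw [← cfcₙ_mul θ χ b hθc.continuousOn hθ0 hχc.continuousOn hχ0]
    congr 1; ext t
    rcases le_total (1 - 4 * |t / t₀ - 1|) 0 with h | h
    · have : θ t = 0 := max_eq_left h
      rw [this, zero_mul]
    · have : χ t = 1 := by
        simp only [hχ]; rw [min_eq_left (by linarith)]; simp
      rw [this, mul_one]
  · exact cfcₙ_nonneg fun t _ => le_max_left _ _
  · refine le_antisymm (norm_cfcₙ_le fun t _ => ?_) ?_
    · rw [Real.norm_of_nonneg (le_max_left _ _)]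
      exact max_le zero_le_one (by linarith [abs_nonneg (t / t₀ - 1)])
    · have := norm_apply_le_norm_cfcₙ θ b ht hθc.continuousOn hθ0 (.of_nonneg hb)
      have h1 : θ t₀ = 1 := by simp [hθ, hpos.ne']
      rwa [h1, norm_one] at this

lemma exists_almost_orthogonal_translates {G : Type*} [Group G] [Fintype G]
    {α : G → A ≃⋆ₐ[ℂ] A} (hW : WeakTracialRokhlin α) {d : A} (hd : 0 ≤ d) (hd1 : ‖d‖ = 1)
    (hdfix : d ∈ fixedPts α) {η : ℝ} (hη : 0 < η) :
    ∃ f : A, IsSelfAdjoint f ∧ ‖f‖ ≤ 1 ∧ 1 / (4 * (Fintype.card G : ℝ)) ≤ ‖f * d‖ ∧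
      ∀ g : G, g ≠ 1 → ‖f * (d * d) * α g f‖ ≤ η := by
  have hN : (1 : ℝ) ≤ Fintype.card G := by exact_mod_cast Fintype.card_pos (α := G)
  set N : ℝ := (Fintype.card G : ℝ)
  set ε : ℝ := min (η / 2) (1 / (4 * N)) with hε
  have hε0 : 0 < ε := by positivity
  have hεη : ε ≤ η / 2 := min_le_left _ _
  have hεN : ε * (4 * N) ≤ 1 := by
    rw [← le_div_iff₀ (by positivity)]
    exact min_le_right _ _
  have hds : IsSelfAdjoint d := .of_nonneg hd
  have hdd : ‖d * d‖ = 1 := by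
    have := CStarRing.norm_self_mul_star (x := d)
    rwa [hds.star_eq, hd1, one_mul] at this
  obtain ⟨f, hf0, hf1, hfo, hfF, hfα, -, hfx⟩ :=
    hW ε hε0 {d * d} (d * d) 0 hds.mul_self_nonneg le_rfl hdd
  have hsa : ∀ g, IsSelfAdjoint (f g) := fun g => .of_nonneg (hf0 g)
  refine ⟨f 1, hsa 1, hf1 1, ?_, fun g hg => ?_⟩
  · by_contra! hlt
    rw [lt_div_iff₀ (by positivity)] at hlt
    have h1 : ∀ g, ‖f g * d‖ ≤ ε + ‖f 1 * d‖ := by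
      intro g
      have e : f g * d = α g (f 1 * d) - (α g (f 1) - f (g * 1)) * d := by
        rw [map_mul, hdfix g, mul_one, sub_mul]; abel
      rw [e]
      refine (norm_sub_le _ _).trans ?_
      rw [StarAlgEquiv.norm_map, add_comm]
      gcongr
      refine (norm_mul_le _ _).trans ?_
      rw [hd1, mul_one]
      exact (hfα g 1).le
    set S := ∑ g, f g with hS
    have hSs : IsSelfAdjoint S := isSelfAdjoint_sum _ fun g _ => hsa g
    have h2 : ‖S * d‖ ≤ N * (ε + ‖f 1 * d‖) := by
      rw [hS, Finset.sum_mul]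
      refine (norm_sum_le_of_le _ fun g _ => h1 g).trans ?_
      rw [Finset.sum_const, Finset.card_univ, nsmul_eq_mul]
    have h3 : ‖S * (d * d) * S‖ = ‖S * d‖ * ‖S * d‖ := by
      rw [← CStarRing.norm_self_mul_star, star_mul, hSs.star_eq, hds.star_eq]
      simp only [mul_assoc]
    rw [h3] at hfx
    have h4 : ‖S * d‖ ≤ 1 / 2 := by nlinarith
    have h5 : ‖S * d‖ * ‖S * d‖ ≤ 1 / 2 * (1 / 2) :=
      mul_le_mul h4 h4 (norm_nonneg _) (by norm_num)
    nlinarith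
  · have e : f 1 * (d * d) * α g (f 1) = -((d * d * f 1 - f 1 * (d * d)) * α g (f 1)) +
        d * d * f 1 * (α g (f 1) - f (g * 1)) := by
      rw [mul_sub, mul_assoc (d * d) (f 1) (f (g * 1)), mul_one, hfo 1 g hg.symm, sub_mul]
      simp
    rw [e]
    refine (norm_add_le _ _).trans ?_
    rw [norm_neg]
    have h1 : ‖(d * d * f 1 - f 1 * (d * d)) * α g (f 1)‖ ≤ ε * 1 := by
      refine (norm_mul_le _ _).trans (mul_le_mul (hfF 1 _ (by simp)).le ?_ (norm_nonneg _) hε0.le)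
      rw [StarAlgEquiv.norm_map]; exact hf1 1
    have h2 : ‖d * d * f 1 * (α g (f 1) - f (g * 1))‖ ≤ 1 * ε := by
      refine (norm_mul_le _ _).trans (mul_le_mul ?_ (hfα g 1).le (norm_nonneg _) zero_le_one)
      refine (norm_mul_le _ _).trans ?_
      rw [hdd, one_mul]; exact hf1 1
    linarith

lemma map_sum_fixed {G : Type*} [Group G] [Fintype G] {α : G → A ≃⋆ₐ[ℂ] A}
    (hα : ∀ g h x, α (g * h) x = α g (α h x)) (s : A) : ∑ g, α g s ∈ fixedPts α := by
  intro h
  rw [map_sum]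
  simp_rw [← hα]
  exact Fintype.sum_equiv (Equiv.mulLeft h) _ _ fun _ => rfl

lemma norm_average_mul_star_sub_le {G : Type*} [Group G] [Fintype G] {α : G → A ≃⋆ₐ[ℂ] A}
    (hα : ∀ g h x, α (g * h) x = α g (α h x)) {s T : A} {ε : ℝ}
    (hT : ∀ g, ‖α g T - T‖ ≤ ε) (hs : ‖s * star s - T‖ ≤ ε)
    (ho : ∀ g, g ≠ 1 → ‖s * star (α g s)‖ ≤ ε / Fintype.card G) :
    ‖((√(Fintype.card G : ℝ))⁻¹ • ∑ g, α g s) * star ((√(Fintype.card G : ℝ))⁻¹ • ∑ g, α g s) - T‖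
      ≤ 3 * ε := by
  classical
  have hN : (1 : ℝ) ≤ Fintype.card G := by exact_mod_cast Fintype.card_pos (α := G)
  have hNe : (Fintype.card G : ℝ) ≠ 0 := by positivity
  have hcard : (Finset.univ : Finset G).card = Fintype.card G := Finset.card_univ
  have hε : 0 ≤ ε := (norm_nonneg _).trans hs
  have h1 : ∀ g h : G, g ≠ h → ‖α g s * star (α h s)‖ ≤ ε / Fintype.card G := by
    intro g h hgh
    have e : α g s * star (α h s) = α g (s * star (α (g⁻¹ * h) s)) := by
      rw [map_mul, map_star, ← hα, mul_inv_cancel_left]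
    rw [e, StarAlgEquiv.norm_map]
    exact ho _ fun h' => hgh (inv_mul_eq_one.1 h')
  have h2 : ∀ g : G, ‖∑ h, α g s * star (α h s) - T‖ ≤ 3 * ε := by
    intro g
    have e : ∑ h, α g s * star (α h s) - T = (α g (s * star s - T) + (α g T - T)) +
        ∑ h ∈ Finset.univ.erase g, α g s * star (α h s) := by
      rw [← Finset.add_sum_erase _ _ (Finset.mem_univ g), map_sub, map_mul, map_star]
      abel
    rw [e]
    have h3 : ‖∑ h ∈ Finset.univ.erase g, α g s * star (α h s)‖ ≤ ε := by
      refine (norm_sum_le_of_le (f := fun h => α g s * star (α h s))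
        (n := fun _ => ε / Fintype.card G) _ fun h hh => h1 g h (Finset.ne_of_mem_erase hh).symm).trans ?_
      rw [Finset.sum_const, nsmul_eq_mul]
      have : ((Finset.univ.erase g).card : ℝ) ≤ Fintype.card G := by
        exact_mod_cast (Finset.card_erase_le).trans hcard.le
      calc _ ≤ (Fintype.card G : ℝ) * (ε / Fintype.card G) := by gcongr
        _ = ε := mul_div_cancel₀ _ hNe
    have h4 : ‖α g (s * star s - T)‖ ≤ ε := by rwa [StarAlgEquiv.norm_map]
    have := norm_add₃_le (a := α g (s * star s - T)) (b := α g T - T)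
      (c := ∑ h ∈ Finset.univ.erase g, α g s * star (α h s))
    linarith [hT g]
  have e : ((√(Fintype.card G : ℝ))⁻¹ • ∑ g, α g s) *
      star ((√(Fintype.card G : ℝ))⁻¹ • ∑ g, α g s) - T =
      (Fintype.card G : ℝ)⁻¹ • ∑ g, (∑ h, α g s * star (α h s) - T) := by
    rw [star_smul, smul_mul_smul_comm, star_trivial, ← mul_inv,
      Real.mul_self_sqrt (by positivity), star_sum, Finset.sum_mul_sum, Finset.sum_sub_distrib,
      smul_sub, Finset.sum_const, hcard, ← Nat.cast_smul_eq_nsmul ℝ, inv_smul_smul₀ hNe]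
  rw [e, norm_smul, norm_inv, Real.norm_of_nonneg (by positivity), inv_mul_le_iff₀ (by positivity)]
  refine (norm_sum_le_of_le _ fun g _ => h2 g).trans ?_
  rw [Finset.sum_const, hcard, nsmul_eq_mul]

lemma exists_cutdown_factorization {x : A} (hx : 0 ≤ x) {κ : ℝ} (hκ : 0 < κ) :
    ∃ p r : A, IsSelfAdjoint p ∧ p * x * (x * p) = cutdown x κ ∧ p * x * r = p ∧
      ‖r‖ ≤ 1 / κ := by
  set ψ : ℝ → ℝ := fun t => √(max (t - κ) 0) / max t κ with hψ
  set ρ : ℝ → ℝ := fun t => min t κ / (κ * max t κ) with hρ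
  have hm : ∀ t, 0 < max t κ := fun t => lt_max_of_lt_right hκ
  have hψc : Continuous ψ := Continuous.div (by fun_prop) (by fun_prop) fun t => (hm t).ne'
  have hρc : Continuous ρ :=
    Continuous.div (by fun_prop) (by fun_prop) fun t => (mul_pos hκ (hm t)).ne'
  have hψ0 : ψ 0 = 0 := by simp [hψ, hκ.le]
  have hρ0 : ρ 0 = 0 := by simp [hρ, hκ.le]
  have hψz : ∀ t, t ≤ κ → ψ t = 0 := fun t ht => by simp [hψ, ht]
  refine ⟨cfcₙ ψ x, cfcₙ ρ x, cfcₙ_predicate _ _, ?_, ?_, ?_⟩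
  · nth_rw 2 [← cfcₙ_id' ℝ x]
    nth_rw 3 [← cfcₙ_id' ℝ x]
    rw [← cfcₙ_mul ψ (fun t => t) x hψc.continuousOn hψ0 (by fun_prop) rfl,
      ← cfcₙ_mul (fun t => t) ψ x (by fun_prop) rfl hψc.continuousOn hψ0,
      ← cfcₙ_mul (fun t => ψ t * t) (fun t => t * ψ t) x (by fun_prop) (by simp) (by fun_prop)
        (by simp), cutdown]
    congr 1; ext t
    rcases le_total t κ with h | h
    · simp [hψz t h, h]
    · have h1 : √(t - κ) * √(t - κ) = t - κ := Real.mul_self_sqrt (by linarith)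
      have ht : t ≠ 0 := by linarith
      simp only [hψ]
      rw [max_eq_left (by linarith : 0 ≤ t - κ), max_eq_left h, div_mul_cancel₀ _ ht,
        mul_div_cancel₀ _ ht, h1]
  · nth_rw 2 [← cfcₙ_id' ℝ x]
    rw [← cfcₙ_mul ψ (fun t => t) x hψc.continuousOn hψ0 (by fun_prop) rfl,
      ← cfcₙ_mul (fun t => ψ t * t) ρ x (by fun_prop) (by simp) hρc.continuousOn hρ0]
    congr 1; ext t
    rcases le_total t κ with h | h
    · simp [hψz t h]
    · have ht : t ≠ 0 := by linarith
      simp only [hρ]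
      rw [min_eq_right h, max_eq_left h]
      field_simp
  · refine norm_cfcₙ_le fun t ht => ?_
    have h0 := quasispectrum_nonneg_of_nonneg x hx t ht
    have h1 : 0 ≤ ρ t := by have := hm t; positivity
    rw [Real.norm_of_nonneg h1]
    simp only [hρ]
    rw [div_le_div_iff₀ (mul_pos hκ (hm t)) hκ, one_mul, mul_comm]
    exact mul_le_mul_of_nonneg_left ((min_le_left t κ).trans (le_max_left t κ)) hκ.le

lemma exists_fixed_remainder {G : Type*} [Group G] [Fintype G] {α : G → A ≃⋆ₐ[ℂ] A}
    (hα : ∀ g h x, α (g * h) x = α g (α h x)) (hW : WeakTracialRokhlin α) {d : A} (hd : 0 ≤ d)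
    (hd1 : ‖d‖ = 1) (hdfix : d ∈ fixedPts α) {C ε : ℝ} (hC : 0 ≤ C) (hε : 0 < ε) :
    ∃ x : A, 0 ≤ x ∧ ‖x‖ = 1 ∧ ∀ T v : A, ‖T‖ ≤ C → (∀ g, ‖α g T - T‖ ≤ ε) →
      ‖v * x * star v - T‖ ≤ ε →
      ∃ z ∈ fixedPts α, (∀ e ∈ fixedPts α, d * e = d → z * e = z) ∧
        ‖z * star z - T‖ ≤ 3 * ε := by
  have hN : (1 : ℝ) ≤ Fintype.card G := by exact_mod_cast Fintype.card_pos (α := G)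
  set N : ℝ := (Fintype.card G : ℝ)
  set κ : ℝ := 1 / (32 * N ^ 2) with hκ
  have hκ0 : 0 < κ := by positivity
  set η : ℝ := ε * κ ^ 2 / (N * (C + ε)) with hη
  have hη0 : 0 < η := by positivity
  obtain ⟨f, hfs, hf1, hfd, hfo⟩ := exists_almost_orthogonal_translates hW hd hd1 hdfix hη0
  have hds : IsSelfAdjoint d := .of_nonneg hd
  set x₀ : A := star (f * d) * (f * d) with hx₀
  have hx₀0 : 0 ≤ x₀ := star_mul_self_nonneg _
  have hx₀s : IsSelfAdjoint x₀ := .of_nonneg hx₀0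
  have hx₀n : 2 * κ ≤ ‖x₀‖ := by
    rw [hx₀, CStarRing.norm_star_mul_self]
    calc 2 * κ = (1 / (4 * N)) * (1 / (4 * N)) := by rw [hκ]; field_simp; norm_num
      _ ≤ _ := mul_le_mul hfd hfd (by positivity) (norm_nonneg _)
  obtain ⟨p, r, hps, hpx, hpr, hr⟩ := exists_cutdown_factorization hx₀0 hκ0
  set x' := cutdown x₀ κ with hx'
  have hx'0 : 0 ≤ x' := cfcₙ_nonneg fun t _ => le_max_right _ _
  have hx'n : 0 < ‖x'‖ := by
    have h1 := norm_cutdown_sub_le hx₀0 hκ0.le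
    have h2 := norm_sub_norm_le x₀ x'
    rw [norm_sub_rev] at h2
    linarith
  have hortho : ∀ g, g ≠ 1 → ‖x₀ * α g x₀‖ ≤ η := by
    intro g hg
    have e : x₀ * α g x₀ = (d * f) * (f * (d * d) * α g f) * (α g f * d) := by
      simp only [hx₀, star_mul, hfs.star_eq, hds.star_eq, map_mul, hdfix g, mul_assoc]
    have h1 : ‖d * f‖ ≤ 1 := (norm_mul_le _ _).trans (by rw [hd1, one_mul]; exact hf1)
    have h2 : ‖α g f * d‖ ≤ 1 := (norm_mul_le _ _).trans (by
      rw [hd1, mul_one, StarAlgEquiv.norm_map]; exact hf1)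
    rw [e]
    calc _ ≤ ‖(d * f) * (f * (d * d) * α g f)‖ * ‖α g f * d‖ := norm_mul_le _ _
      _ ≤ ‖(d * f) * (f * (d * d) * α g f)‖ := mul_le_of_le_one_right (norm_nonneg _) h2
      _ ≤ ‖d * f‖ * ‖f * (d * d) * α g f‖ := norm_mul_le _ _
      _ ≤ ‖f * (d * d) * α g f‖ := mul_le_of_le_one_left (norm_nonneg _) h1
      _ ≤ η := hfo g hg
  refine ⟨‖x'‖⁻¹ • x', smul_nonneg (by positivity) hx'0, ?_, fun T v hTC hTα hv => ?_⟩
  · rw [norm_smul, norm_inv, norm_norm, inv_mul_cancel₀ hx'n.ne']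
  set q : A := (√‖x'‖)⁻¹ • (v * p) with hq
  set s : A := q * x₀ with hs
  have hss : s * star s = v * (‖x'‖⁻¹ • x') * star v := by
    have hinv : (√‖x'‖)⁻¹ * (√‖x'‖)⁻¹ = ‖x'‖⁻¹ := by
      rw [← mul_inv, Real.mul_self_sqrt (norm_nonneg _)]
    rw [← hinv, hs, hq]
    generalize (√‖x'‖)⁻¹ = ρ
    rw [← hpx]
    simp only [star_mul, star_smul, star_trivial, hx₀s.star_eq, hps.star_eq,
      smul_mul_assoc, mul_smul_comm, mul_assoc, smul_smul]
  have hsn : ‖s‖ * ‖s‖ ≤ C + ε := by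
    rw [← CStarRing.norm_self_mul_star, hss]
    have := norm_add_le (v * (‖x'‖⁻¹ • x') * star v - T) T
    rw [sub_add_cancel] at this
    linarith
  have hsr : s * r = q := by
    simp only [hs, hq, smul_mul_assoc]
    rw [mul_assoc v, mul_assoc v, hpr]
  have hqn : ‖q‖ * ‖q‖ ≤ (C + ε) / κ ^ 2 := by
    have h1 : ‖q‖ ≤ ‖s‖ * (1 / κ) := by
      rw [← hsr]
      exact (norm_mul_le _ _).trans (mul_le_mul_of_nonneg_left hr (norm_nonneg _))
    calc ‖q‖ * ‖q‖ ≤ (‖s‖ * (1 / κ)) * (‖s‖ * (1 / κ)) :=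
          mul_le_mul h1 h1 (norm_nonneg _) (by positivity)
      _ = (‖s‖ * ‖s‖) / κ ^ 2 := by field_simp
      _ ≤ _ := by gcongr
  have ho : ∀ g, g ≠ 1 → ‖s * star (α g s)‖ ≤ ε / Fintype.card G := by
    intro g hg
    have e : s * star (α g s) = q * (x₀ * α g x₀) * star (α g q) := by
      simp only [hs, map_mul, star_mul, ← map_star, hx₀s.star_eq, mul_assoc]
    rw [e]
    calc _ ≤ ‖q‖ * ‖x₀ * α g x₀‖ * ‖star (α g q)‖ :=
          (norm_mul_le _ _).trans (mul_le_mul_of_nonneg_right (norm_mul_le _ _) (norm_nonneg _))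
      _ = ‖q‖ * ‖q‖ * ‖x₀ * α g x₀‖ := by rw [norm_star, StarAlgEquiv.norm_map]; ring
      _ ≤ (C + ε) / κ ^ 2 * η :=
          mul_le_mul hqn (hortho g hg) (norm_nonneg _) (by positivity)
      _ = ε / N := by rw [hη]; field_simp
  refine ⟨(√N)⁻¹ • ∑ g, α g s, fun g => ?_, fun e he hde => ?_,
    norm_average_mul_star_sub_le hα hTα (by rwa [hss]) ho⟩
  · rw [map_real_smul (α g) (StarAlgEquiv.isometry (α g)).continuous, map_sum_fixed hα s g]
  · have hse : s * e = s := by simp only [hs, hx₀, mul_assoc, hde]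
    rw [smul_mul_assoc, Finset.sum_mul]
    congr 2; ext g
    nth_rw 1 [← he g]
    rw [← map_mul, hse]

lemma norm_rokhlin_sum_sub_le {G : Type*} [Group G] [Fintype G] {α : G → A ≃⋆ₐ[ℂ] A}
    {w c a y : A} (hcfix : c ∈ fixedPts α) (hafix : a ∈ fixedPts α)
    (hy : y * y = a) {δ : ℝ} {u f : G → A} (hus : ∀ g, IsSelfAdjoint (u g))
    (hu1 : ∀ g, ‖u g‖ ≤ 1) (huo : ∀ g h, g ≠ h → u g * u h = 0)
    (huX : ∀ k g h, ‖α g w * c * star (α h w) * u k - u k * (α g w * c * star (α h w))‖ ≤ δ)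
    (huα : ∀ g h, ‖α g (u h) - u (g * h)‖ ≤ δ) (huf : ∀ g, ‖u g * u g - f g‖ ≤ δ)
    (hf1 : ∀ g, ‖f g‖ ≤ 1) (hfy : ∀ g, ‖y * f g - f g * y‖ ≤ δ) :
    ‖(∑ g, α g (u 1 * w)) * c * star (∑ g, α g (u 1 * w)) - y * (∑ g, f g) * y‖ ≤
      (Fintype.card G : ℝ) ^ 2 * (3 * δ * (‖w‖ * ‖c‖ * ‖w‖) + δ) +
        Fintype.card G * (‖w * c * star w - a‖ + δ * ‖y‖) := by
  classical
  have hcard : (Finset.univ : Finset G).card = Fintype.card G := Finset.card_univ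
  set M := ‖w‖ * ‖c‖ * ‖w‖ with hM
  set E := ‖w * c * star w - a‖ with hE
  set X : G → G → A := fun g h => α g w * c * star (α h w) with hX
  have hδ : 0 ≤ δ := (norm_nonneg _).trans (huα 1 1)
  have hM0 : 0 ≤ M := by positivity
  have hXn : ∀ g h, ‖X g h‖ ≤ M := by
    intro g h
    refine (norm_mul_le _ _).trans ?_
    rw [norm_star, StarAlgEquiv.norm_map]
    refine mul_le_mul_of_nonneg_right ((norm_mul_le _ _).trans ?_) (norm_nonneg _)
    rw [StarAlgEquiv.norm_map]
  have hXα : ∀ g, X g g = α g (w * c * star w) := by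
    intro g; simp only [hX, map_mul, map_star, hcfix g]
  have hterm : ∀ g h, ‖α g (u 1) * X g h * α h (u 1) - u g * u h * X g h‖ ≤ 2 * δ * M + δ := by
    intro g h
    have e : α g (u 1) * X g h * α h (u 1) - u g * u h * X g h =
        (α g (u 1) - u (g * 1)) * X g h * α h (u 1) + u g * X g h * (α h (u 1) - u (h * 1)) +
          u g * (X g h * u h - u h * X g h) := by
      simp only [mul_one, mul_sub, sub_mul, mul_assoc]; abel
    have h1 : ‖(α g (u 1) - u (g * 1)) * X g h * α h (u 1)‖ ≤ δ * M * 1 := by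
      refine (norm_mul_le _ _).trans (mul_le_mul ((norm_mul_le _ _).trans
        (mul_le_mul (huα g 1) (hXn g h) (norm_nonneg _) hδ)) ?_ (norm_nonneg _) (by positivity))
      rw [StarAlgEquiv.norm_map]; exact hu1 1
    have h2 : ‖u g * X g h * (α h (u 1) - u (h * 1))‖ ≤ 1 * M * δ :=
      (norm_mul_le _ _).trans (mul_le_mul ((norm_mul_le _ _).trans
        (mul_le_mul (hu1 g) (hXn g h) (norm_nonneg _) zero_le_one)) (huα h 1) (norm_nonneg _)
          (by positivity))
    have h3 : ‖u g * (X g h * u h - u h * X g h)‖ ≤ 1 * δ :=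
      (norm_mul_le _ _).trans (mul_le_mul (hu1 g) (huX h g h) (norm_nonneg _) zero_le_one)
    rw [e]
    refine (norm_add₃_le).trans ?_
    linarith
  have hdiag : ∀ g, ‖u g * u g * X g g - f g * a‖ ≤ δ * M + E := by
    intro g
    have e : u g * u g * X g g - f g * a =
        (u g * u g - f g) * X g g + f g * α g (w * c * star w - a) := by
      rw [map_sub, ← hXα, hafix g, sub_mul, mul_sub]; abel
    rw [e]
    refine (norm_add_le _ _).trans (add_le_add ((norm_mul_le _ _).trans
      (mul_le_mul (huf g) (hXn g g) (norm_nonneg _) hδ)) ((norm_mul_le _ _).trans ?_))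
    rw [StarAlgEquiv.norm_map]
    exact mul_le_of_le_one_left (norm_nonneg _) (hf1 g)
  have hfa : ∀ g, ‖f g * a - y * f g * y‖ ≤ δ * ‖y‖ := by
    intro g
    have e : f g * a - y * f g * y = -((y * f g - f g * y) * y) := by
      rw [← hy, sub_mul, ← mul_assoc]; abel
    rw [e, norm_neg]
    exact (norm_mul_le _ _).trans (mul_le_mul_of_nonneg_right (hfy g) (norm_nonneg _))
  have hdelta : ∀ g, ∑ h, u g * u h * X g h = u g * u g * X g g := by
    intro g
    refine Finset.sum_eq_single g (fun h _ hh => ?_) (by simp)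
    rw [huo g h hh.symm, zero_mul]
  have e : (∑ g, α g (u 1 * w)) * c * star (∑ g, α g (u 1 * w)) - y * (∑ g, f g) * y =
      ∑ g, ∑ h, (α g (u 1) * X g h * α h (u 1) - u g * u h * X g h) +
        ∑ g, ((u g * u g * X g g - f g * a) + (f g * a - y * f g * y)) := by
    have e1 : (∑ g, α g (u 1 * w)) * c * star (∑ g, α g (u 1 * w)) =
        ∑ g, ∑ h, α g (u 1) * X g h * α h (u 1) := by
      rw [star_sum, Finset.sum_mul, Finset.sum_mul_sum]
      refine Finset.sum_congr rfl fun g _ => Finset.sum_congr rfl fun h _ => ?_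
      simp only [hX, map_mul, star_mul, ← map_star, (hus 1).star_eq, mul_assoc]
    have e2 : y * (∑ g, f g) * y = ∑ g, y * f g * y := by
      rw [Finset.mul_sum, Finset.sum_mul]
    simp only [e1, e2, Finset.sum_sub_distrib, Finset.sum_add_distrib, hdelta]
    abel
  rw [e]
  refine (norm_add_le _ _).trans ?_
  have b1 : ‖∑ g, ∑ h, (α g (u 1) * X g h * α h (u 1) - u g * u h * X g h)‖ ≤
      (Fintype.card G : ℝ) ^ 2 * (2 * δ * M + δ) := by
    refine (norm_sum_le_of_le _ fun g _ => norm_sum_le_of_le _ fun h _ => hterm g h).trans ?_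
    simp only [Finset.sum_const, hcard, nsmul_eq_mul]
    exact le_of_eq (by ring)
  have b2 : ‖∑ g, ((u g * u g * X g g - f g * a) + (f g * a - y * f g * y))‖ ≤
      (Fintype.card G : ℝ) * (δ * M + E + δ * ‖y‖) := by
    refine (norm_sum_le_of_le _ fun g _ => (norm_add_le _ _).trans
      (add_le_add (hdiag g) (hfa g))).trans ?_
    simp only [Finset.sum_const, hcard, nsmul_eq_mul]
    exact le_rfl
  have hN : (1 : ℝ) ≤ Fintype.card G := by exact_mod_cast Fintype.card_pos (α := G)
  have : (Fintype.card G : ℝ) * (δ * M) ≤ (Fintype.card G : ℝ) ^ 2 * (δ * M) := by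
    gcongr
    nlinarith
  nlinarith

lemma exists_fixed_norm_sub_lt {G : Type*} [Group G] [Fintype G] {α : G → A ≃⋆ₐ[ℂ] A}
    (hα : ∀ g h x, α (g * h) x = α g (α h x)) (hW : WeakTracialRokhlin α) {a b : A}
    (ha : 0 ≤ a) (hb : 0 ≤ b) (hafix : a ∈ fixedPts α) (hbfix : b ∈ fixedPts α)
    (hsp : AccPt (0 : ℝ) (𝓟 (quasispectrum ℝ b))) (hab : CuntzLEIn Set.univ a b)
    {ε : ℝ} (hε : 0 < ε) : ∃ W ∈ fixedPts α, ‖W * b * star W - a‖ < ε := by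
  classical
  have hN : (1 : ℝ) ≤ Fintype.card G := by exact_mod_cast Fintype.card_pos (α := G)
  set N : ℝ := (Fintype.card G : ℝ)
  have hcfc : ∀ {h : ℝ → ℝ} {t : A}, IsSelfAdjoint t → t ∈ fixedPts α → Continuous h ∧ h 0 = 0 →
      cfcₙ h t ∈ fixedPts α := by
    intro h t hts ht hh g
    rw [map_cfcₙ_real _ h hh.1 hh.2 t hts, ht g]
  obtain ⟨w', -, hw'⟩ := hab
  obtain ⟨k, hk⟩ := ((tendsto_order.1 hw').2 (ε / (8 * N)) (by positivity)).exists
  set w := w' k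
  set δ₁ : ℝ := ε / (8 * N) / (‖w‖ * ‖w‖ + 1) with hδ₁
  have hδ₁0 : 0 < δ₁ := by positivity
  obtain ⟨μ, ν, θ, χ, hμ, hν, hθ, hχ, h1, h2, h3, h4, h5, h6, h7⟩ :=
    exists_separating_cfc hb hsp hδ₁0
  have hbs : IsSelfAdjoint b := .of_nonneg hb
  have hmfix := hcfc hbs hbfix hμ
  have hnfix := hcfc hbs hbfix hν
  have hdfix := hcfc hbs hbfix hθ
  have hefix := hcfc hbs hbfix hχ
  have hms : IsSelfAdjoint (cfcₙ μ b) := cfcₙ_predicate _ _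
  have hns : IsSelfAdjoint (cfcₙ ν b) := cfcₙ_predicate _ _
  set m := cfcₙ μ b
  set n := cfcₙ ν b
  set d := cfcₙ θ b
  set e := cfcₙ χ b
  set c := m * b * m with hc
  have hcfix : c ∈ fixedPts α := fun g => by rw [hc, map_mul, map_mul, hmfix g, hbfix g]
  have hE : ‖w * c * star w - a‖ ≤ ε / (4 * N) := by
    have e1 : w * c * star w - a = w * (c - b) * star w + (w * b * star w - a) := by
      rw [mul_sub, sub_mul]; abel
    have e2 : ‖w * (c - b) * star w‖ ≤ ε / (8 * N) := by
      calc _ ≤ ‖w‖ * ‖c - b‖ * ‖star w‖ :=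
            (norm_mul_le _ _).trans (mul_le_mul_of_nonneg_right (norm_mul_le _ _) (norm_nonneg _))
        _ = ‖w‖ * ‖w‖ * ‖c - b‖ := by rw [norm_star]; ring
        _ ≤ (‖w‖ * ‖w‖ + 1) * δ₁ :=
            mul_le_mul (by linarith) h1 (norm_nonneg _) (by positivity)
        _ = ε / (8 * N) := by rw [hδ₁]; exact mul_div_cancel₀ _ (by positivity)
    rw [e1]
    refine (norm_add_le _ _).trans ((add_le_add e2 hk.le).trans_eq ?_)
    field_simp; norm_num
  set y := cfcₙ Real.sqrt a
  have has : IsSelfAdjoint a := .of_nonneg ha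
  have hyfix : y ∈ fixedPts α := hcfc has hafix ⟨Real.continuous_sqrt, Real.sqrt_zero⟩
  have hy0 : 0 ≤ y := cfcₙ_nonneg fun t _ => Real.sqrt_nonneg t
  have hyy : y * y = a := by
    rw [← cfcₙ_mul Real.sqrt Real.sqrt a Real.continuous_sqrt.continuousOn Real.sqrt_zero
      Real.continuous_sqrt.continuousOn Real.sqrt_zero]
    nth_rw 2 [← cfcₙ_id' ℝ a]
    exact cfcₙ_congr fun t ht => Real.mul_self_sqrt (quasispectrum_nonneg_of_nonneg a ha t ht)
  set C := ‖y‖ * ‖y‖ + ‖y‖ * N * ‖y‖ with hC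
  obtain ⟨x, hx0, hx1, hx⟩ := exists_fixed_remainder hα hW h6 h7 hdfix
    (C := C) (ε := ε / 12) (by positivity) (by positivity)
  set M := ‖w‖ * ‖c‖ * ‖w‖ with hM
  set K := N ^ 2 * (3 * M + 1) + N * ‖y‖ with hK
  have hM0 : 0 ≤ M := by positivity
  have hK0 : 0 < K := by positivity
  set δ : ℝ := min (min (ε / 4 / K) (ε / 12)) (ε / 12 / (‖y‖ * N * ‖y‖ + 1)) with hδ
  have hδ0 : 0 < δ := by positivity
  have hδK : δ * K ≤ ε / 4 := by
    rw [← le_div_iff₀ hK0]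
    exact (min_le_left _ _).trans (min_le_left _ _)
  have hδε : δ ≤ ε / 12 := (min_le_left _ _).trans (min_le_right _ _)
  have hδy : δ * (‖y‖ * N * ‖y‖ + 1) ≤ ε / 12 := by
    rw [← le_div_iff₀ (by positivity)]
    exact min_le_right _ _
  obtain ⟨u, f, v, hus, hu1, huo, huF, huα, huf, hf1, hfF, hfα, hv⟩ := hW.exists_sqrt hδ0
    (insert y ((Finset.univ : Finset (G × G)).image
      fun p => α p.1 w * c * star (α p.2 w))) hx0 hy0 hx1
  have hmain := norm_rokhlin_sum_sub_le (w := w) hcfix hafix hyy hus hu1 huo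
    (fun k g h => huF k _ (Finset.mem_insert_of_mem
      (Finset.mem_image.2 ⟨(g, h), Finset.mem_univ _, rfl⟩))) huα huf hf1
    (fun g => hfF g _ (Finset.mem_insert_self _ _))
  set V := ∑ g, α g (u 1 * w)
  set S := ∑ g, f g with hS
  have hVfix : V ∈ fixedPts α := map_sum_fixed hα _
  have hSn : ‖S‖ ≤ N := by
    refine (norm_sum_le_of_le _ fun g _ => hf1 g).trans ?_
    simp [N]
  have hTC : ‖y * y - y * S * y‖ ≤ C := by
    refine (norm_sub_le _ _).trans (add_le_add (norm_mul_le _ _) ?_)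
    refine (norm_mul_le _ _).trans (mul_le_mul_of_nonneg_right ?_ (norm_nonneg _))
    exact (norm_mul_le _ _).trans (mul_le_mul_of_nonneg_left hSn (norm_nonneg _))
  have hTα : ∀ g, ‖α g (y * y - y * S * y) - (y * y - y * S * y)‖ ≤ ε / 12 := by
    intro g
    have hSα : ‖S - α g S‖ ≤ N * δ := by
      have e1 : S - α g S = ∑ h, (f (g * h) - α g (f h)) := by
        rw [Finset.sum_sub_distrib, hS, map_sum]
        congr 1
        exact (Fintype.sum_equiv (Equiv.mulLeft g) _ _ fun _ => rfl).symm
      rw [e1]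
      refine (norm_sum_le_of_le _ fun h _ => (norm_sub_rev _ _).trans_le (hfα g h)).trans ?_
      simp [N]
    have e1 : α g (y * y - y * S * y) - (y * y - y * S * y) = y * (S - α g S) * y := by
      rw [map_sub, map_mul, map_mul, map_mul, hyfix g, mul_sub, sub_mul]; abel
    rw [e1]
    calc _ ≤ ‖y‖ * ‖S - α g S‖ * ‖y‖ :=
          (norm_mul_le _ _).trans (mul_le_mul_of_nonneg_right (norm_mul_le _ _) (norm_nonneg _))
      _ ≤ ‖y‖ * (N * δ) * ‖y‖ := by gcongr
      _ ≤ ε / 12 := by nlinarith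
  obtain ⟨z, hzfix, hze, hz⟩ := hx (y * y - y * S * y) v hTC hTα (hv.trans hδε)
  have hze' : z * e = z := hze e hefix h5
  refine ⟨V * m + z * n, fun g => ?_, ?_⟩
  · rw [map_add, map_mul, map_mul, hVfix g, hmfix g, hzfix g, hnfix g]
  · have e1 : (V * m + z * n) * b * star (V * m + z * n) - a =
        (V * c * star V - y * S * y) + (z * star z - (y * y - y * S * y)) := by
      have e2 : (V * m + z * n) * b * star (V * m + z * n) = V * c * star V +
          V * (m * b * n) * star z + z * (n * b * m) * star V + z * (n * b * n) * star z := by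
        simp only [hc, star_add, star_mul, hms.star_eq, hns.star_eq, add_mul, mul_add, mul_assoc]
        abel
      rw [e2, h2, h3, h4, hze', hyy]
      simp only [mul_zero, zero_mul]
      abel
    rw [e1]
    refine (norm_add_le _ _).trans_lt ((add_le_add hmain hz).trans_lt ?_)
    have hNE : N * ‖w * c * star w - a‖ ≤ ε / 4 := by
      rw [le_div_iff₀ (by positivity)] at hE
      linarith
    have : N ^ 2 * (3 * δ * M + δ) + N * (‖w * c * star w - a‖ + δ * ‖y‖) =
        δ * K + N * ‖w * c * star w - a‖ := by rw [hK]; ring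
    linarith

/-- Let `A` be a simple infinite-dimensional C*-algebra and let `α` be
an action of a finite group `G` on `A` with the weak tracial Rokhlin property.  Let
`a, b` be positive elements of the fixed point algebra `A^α` such that `0` is an
accumulation point of the spectrum of `b` (computed in the unitization, i.e. the
quasispectrum).  Then `a ≾_A b` if and only if `a ≾_{A^α} b`, i.e. the witnessing
sequence can be taken in `A^α`. -/
theorem cuntzLE_iff_cuntzLE_fixedPts
    {G : Type*} [Group G] [Fintype G]
    (hA : IsSimpleCStarAlgebra A) (hinf : ¬ FiniteDimensional ℂ A)
    (α : G → A ≃⋆ₐ[ℂ] A) (hα : ∀ g h x, α (g * h) x = α g (α h x))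
    (hwtrp : WeakTracialRokhlin α)
    (a b : A) (ha : 0 ≤ a) (hb : 0 ≤ b)
    (hafix : a ∈ fixedPts α) (hbfix : b ∈ fixedPts α)
    (hsp : AccPt (0 : ℝ) (Filter.principal (quasispectrum ℝ b))) :
    CuntzLEIn Set.univ a b ↔ CuntzLEIn (fixedPts α) a b := by
  refine ⟨fun h => ?_, fun ⟨w, _, hw⟩ => ⟨w, fun _ => Set.mem_univ _, hw⟩⟩
  choose W hW hWlt using fun n : ℕ => exists_fixed_norm_sub_lt hα hwtrp ha hb hafix hbfix hsp h
    (Nat.one_div_pos_of_nat (α := ℝ) (n := n))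
  exact ⟨W, hW, squeeze_zero (fun _ => norm_nonneg _) (fun n => (hWlt n).le)
    tendsto_one_div_add_atTop_nhds_zero_nat⟩
end
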